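/- Every connected simple graph with n ≥ 8 vertices in which every vertex has degree at least 2 has a dominating set of size at most 2n/5. -/

import Mathlib

/-- `D` is a dominating set of `G`: every vertex is in `D` or adjacent to a vertex of `D`. -/
def IsDominatingSet {V : Type*} (G : SimpleGraph V) (D : Finset V) : Prop :=
  ∀ v : V, v ∈ D ∨ ∃ u ∈ D, G.Adj u v

namespace TwoFifths

variable {V : Type*}

/-- The neighbours of `v` lying in `S`. -/
noncomputable def nbrs (H : SimpleGraph V) (S : Finset V) (v : V) : Finset V :=
  open Classical in S.filter (H.Adj v)

@[simp]
theorem mem_nbrs {H : SimpleGraph V} {S : Finset V} {v x : V} :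
    x ∈ nbrs H S v ↔ x ∈ S ∧ H.Adj v x := by
  simp [nbrs]

/-- The subgraph of `H` induced on `S` is connected (or empty), in terms of cuts. -/
def Conn (H : SimpleGraph V) (S : Finset V) : Prop :=
  ∀ A ⊆ S, A.Nonempty → (∀ a ∈ A, ∀ b ∈ S, H.Adj a b → b ∈ A) → A = S

/-- Every vertex of `X` is in `D` or adjacent to a vertex of `D`. -/
def Dom (H : SimpleGraph V) (D X : Finset V) : Prop :=
  ∀ v ∈ X, v ∈ D ∨ ∃ u ∈ D, H.Adj u v

/-- The subgraph of `H` induced on `S` is connected with minimum degree at least two. -/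
structure Adm (H : SimpleGraph V) (S : Finset V) : Prop where
  conn : Conn H S
  deg : ∀ v ∈ S, 2 ≤ (nbrs H S v).card

/-- The subgraph induced on `S` has a dominating set of size at most `2|S|/5`. -/
def Cheap (H : SimpleGraph V) (S : Finset V) : Prop :=
  ∃ D ⊆ S, Dom H D S ∧ 5 * D.card ≤ 2 * S.card

/-- `S` has four or seven vertices, and all of them but any prescribed one can be dominated by
`(|S| - 1) / 3` vertices. -/
def Critical [DecidableEq V] (H : SimpleGraph V) (S : Finset V) : Prop :=
  (S.card = 4 ∨ S.card = 7) ∧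
    ∀ v ∈ S, ∃ D ⊆ S, Dom H D (S.erase v) ∧ 3 * D.card + 1 ≤ S.card

/-- A counterexample to the dichotomy `Cheap ∨ Critical`, minimal with respect to the number of
vertices and then to the set of edges. -/
structure MinCex [DecidableEq V] (H : SimpleGraph V) (S : Finset V) : Prop extends Adm H S where
  not_cheap : ¬ Cheap H S
  not_critical : ¬ Critical H S
  of_card_lt : ∀ (H' : SimpleGraph V) (S' : Finset V), S'.card < S.card → Adm H' S' →
    Cheap H' S' ∨ Critical H' S'
  of_lt : ∀ H' < H, Adm H' S → Cheap H' S ∨ Critical H' S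

theorem Dom.mono {H H' : SimpleGraph V} {D D' X : Finset V} (h : Dom H D X) (hH : H ≤ H')
    (hD : D ⊆ D') : Dom H' D' X := by
  intro v hv
  rcases h v hv with h | ⟨u, hu, huv⟩
  · exact Or.inl (hD h)
  · exact Or.inr ⟨u, hD hu, hH huv⟩

theorem Cheap.mono {H H' : SimpleGraph V} {S : Finset V} (h : Cheap H S) (hH : H ≤ H') :
    Cheap H' S := by
  obtain ⟨D, hD, hdom, hc⟩ := h
  exact ⟨D, hD, hdom.mono hH subset_rfl, hc⟩

/-- The neighbours of `v` in `S` are the two distinct vertices `x` and `y`. -/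
def HasNbrs (H : SimpleGraph V) (S : Finset V) (v x y : V) : Prop :=
  x ∈ S ∧ y ∈ S ∧ x ≠ y ∧ ∀ z ∈ S, H.Adj v z ↔ z = x ∨ z = y

theorem HasNbrs.symm {H : SimpleGraph V} {S : Finset V} {v x y : V} (h : HasNbrs H S v x y) :
    HasNbrs H S v y x := by
  obtain ⟨h1, h2, h3, h4⟩ := h
  exact ⟨h2, h1, h3.symm, fun z hz => (h4 z hz).trans or_comm⟩

theorem HasNbrs.adj_iff {H : SimpleGraph V} {S : Finset V} {v x y z : V}
    (h : HasNbrs H S v x y) (hz : z ∈ S) : H.Adj v z ↔ z = x ∨ z = y :=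
  h.2.2.2 z hz

theorem sum_card_nbrs_comm (H : SimpleGraph V) (A X : Finset V) :
    ∑ w ∈ X, (nbrs H A w).card = ∑ x ∈ A, (nbrs H X x).card := by
  classical
  simp only [nbrs]
  have := Finset.sum_card_bipartiteAbove_eq_sum_card_bipartiteBelow (s := X) (t := A) H.Adj
  simpa [Finset.bipartiteAbove, Finset.bipartiteBelow, H.adj_comm] using this

theorem conn_singleton (H : SimpleGraph V) (s : V) : Conn H {s} := by
  intro A hA hne _
  exact (Finset.subset_singleton_iff.1 hA).resolve_left hne.ne_empty

theorem conn_univ [Fintype V] {G : SimpleGraph V} (hG : G.Connected) : Conn G Finset.univ := by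
  intro A _ hne hcl
  obtain ⟨a, ha⟩ := hne
  refine Finset.eq_univ_iff_forall.2 fun v => ?_
  obtain ⟨p⟩ := hG.preconnected a v
  induction p with
  | nil => exact ha
  | cons hadj _ ih => exact ih (hcl _ ha _ (Finset.mem_univ _) hadj)

variable [DecidableEq V]

theorem Critical.mono {H H' : SimpleGraph V} {S : Finset V} (h : Critical H S) (hH : H ≤ H') :
    Critical H' S := by
  refine ⟨h.1, fun v hv => ?_⟩
  obtain ⟨D, hD, hdom, hc⟩ := h.2 v hv
  exact ⟨D, hD, hdom.mono hH subset_rfl, hc⟩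

theorem exists_other_nbr {H : SimpleGraph V} {S : Finset V} {v x : V}
    (h2 : (nbrs H S v).card = 2) (hx : x ∈ S) (hvx : H.Adj v x) :
    ∃ y ∈ S, y ≠ x ∧ H.Adj v y ∧ ∀ z ∈ S, H.Adj v z → z = x ∨ z = y := by
  obtain ⟨p, q, hpq, h⟩ := Finset.card_eq_two.1 h2
  have hm : ∀ z, (z ∈ S ∧ H.Adj v z) ↔ z = p ∨ z = q := by
    intro z
    rw [← mem_nbrs, h]
    simp
  rcases (hm x).1 ⟨hx, hvx⟩ with rfl | rfl
  · exact ⟨q, ((hm q).2 (Or.inr rfl)).1, hpq.symm, ((hm q).2 (Or.inr rfl)).2,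
      fun z hz hvz => (hm z).1 ⟨hz, hvz⟩⟩
  · exact ⟨p, ((hm p).2 (Or.inl rfl)).1, hpq, ((hm p).2 (Or.inl rfl)).2,
      fun z hz hvz => ((hm z).1 ⟨hz, hvz⟩).symm⟩

theorem Conn.sdiff {H : SimpleGraph V} {S K : Finset V} {z : V} (h : Conn H S) (hK : K ⊆ S)
    (hz : z ∈ S \ K) (hedge : ∀ x ∈ K, ∀ y ∈ S \ K, H.Adj x y → y = z) : Conn H (S \ K) := by
  intro A hA hne hcl
  by_cases hzA : z ∈ A
  · have hAK : A ∪ K = S := by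
      apply h _ (by grind) ⟨z, by grind⟩
      intro a ha b hb hab
      by_cases hbK : b ∈ K
      · grind
      · have : b ∈ S \ K := by grind
        rcases Finset.mem_union.1 ha with ha | ha
        · grind
        · have := hedge a ha b this hab
          grind
    grind
  · have hAS : A = S := by
      apply h _ (by grind) hne
      intro a ha b hb hab
      by_cases hbK : b ∈ K
      · have := hedge b hbK a (hA ha) hab.symm
        grind
      · grind
    grind

theorem Adm.sdiff {H : SimpleGraph V} {S K : Finset V} {z : V} (h : Adm H S) (hK : K ⊆ S)
    (hz : z ∈ S \ K) (hedge : ∀ x ∈ K, ∀ y ∈ S \ K, H.Adj x y → y = z)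
    (hdeg : 2 ≤ (nbrs H (S \ K) z).card) : Adm H (S \ K) := by
  refine ⟨h.conn.sdiff hK hz hedge, fun v hv => ?_⟩
  by_cases hvz : v = z
  · rwa [hvz]
  · have : nbrs H (S \ K) v = nbrs H S v := by
      ext x
      have h1 := hedge x
      have h2 := H.adj_comm v x
      grind [mem_nbrs]
    rw [this]
    exact h.deg v (by grind)

theorem card_nbrs_sdiff {H : SimpleGraph V} {S K : Finset V} {z : V} :
    (nbrs H S z).card ≤ (nbrs H (S \ K) z).card + (nbrs H K z).card := by
  have : nbrs H S z ⊆ nbrs H (S \ K) z ∪ nbrs H K z := by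
    intro x hx
    grind [mem_nbrs]
  exact (Finset.card_le_card this).trans (Finset.card_union_le _ _)

theorem Conn.exists_cut {H : SimpleGraph V} {S : Finset V} {u w : V} (h : Conn H S)
    (hu : u ∈ S) (hw : w ∈ S) (hnc : ¬ Conn (H.deleteEdges {s(u, w)}) S) :
    ∃ A ⊆ S, u ∈ A ∧ w ∈ S \ A ∧ ∀ x ∈ A, ∀ y ∈ S \ A, H.Adj x y → x = u ∧ y = w := by
  unfold Conn at hnc
  push Not at hnc
  obtain ⟨A, hA, hne, hcl, hAS⟩ := hnc
  have hcl' : ∀ x ∈ A, ∀ y ∈ S \ A, H.Adj x y → (x = u ∧ y = w) ∨ (x = w ∧ y = u) := by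
    intro x hx y hy hxy
    by_contra hcon
    have hy' := Finset.mem_sdiff.1 hy
    refine hy'.2 (hcl x hx y hy'.1 ?_)
    simp [SimpleGraph.deleteEdges_adj, hxy]
    grind
  by_cases huA : u ∈ A
  · by_cases hwA : w ∈ A
    · exact absurd (h A hA hne (by grind)) hAS
    · exact ⟨A, hA, huA, by grind, by grind⟩
  · by_cases hwA : w ∈ A
    · refine ⟨S \ A, by grind, by grind, by grind, ?_⟩
      intro x hx y hy hxy
      have := hcl' y (by grind) x (by grind) hxy.symm
      grind
    · exact absurd (h A hA hne (by grind)) hAS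

theorem Adm.sdiff_of_cut {H : SimpleGraph V} {S A : Finset V} {u w : V} (h : Adm H S)
    (hA : A ⊆ S) (hw : w ∈ S \ A) (hw3 : 3 ≤ (nbrs H S w).card)
    (hcut : ∀ x ∈ A, ∀ y ∈ S \ A, H.Adj x y → x = u ∧ y = w) : Adm H (S \ A) := by
  refine h.sdiff hA hw (fun x hx y hy hxy => (hcut x hx y hy hxy).2) ?_
  have h1 : (nbrs H S w).card ≤ _ := card_nbrs_sdiff (K := A)
  have h2 : nbrs H A w ⊆ {u} := by
    intro x hx
    have := hcut x (by grind [mem_nbrs]) w hw (by grind [mem_nbrs, H.adj_comm])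
    grind
  have h3 := Finset.card_le_card h2
  simp only [Finset.card_singleton] at h3
  omega

/-- `A` is a critical piece of `S`, attached to the rest of `S` by the single edge `uw`. -/
structure Satellite (H : SimpleGraph V) (S A : Finset V) (u w : V) : Prop where
  subset : A ⊆ S
  mem : u ∈ A
  mem_sdiff : w ∈ S \ A
  cut : ∀ x ∈ A, ∀ y ∈ S \ A, H.Adj x y → x = u ∧ y = w
  conn : Conn H A
  critical : Critical H A

theorem MinCex.satellite {H : SimpleGraph V} {S : Finset V} {u w : V} (h : MinCex H S)
    (hu : u ∈ S) (hw : w ∈ S) (hu3 : 3 ≤ (nbrs H S u).card) (hw3 : 3 ≤ (nbrs H S w).card)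
    (huw : H.Adj u w) :
    (∃ A, Satellite H S A u w) ∨ ∃ A, Satellite H S A w u := by
  have hnc : ¬ Conn (H.deleteEdges {s(u, w)}) S := by
    intro hc
    have hlt : H.deleteEdges {s(u, w)} < H := by
      refine lt_of_le_of_ne (H.deleteEdges_le _) ?_
      intro he
      have : (H.deleteEdges {s(u, w)}).Adj u w := by rw [he]; exact huw
      simp at this
    have hadm : Adm (H.deleteEdges {s(u, w)}) S := by
      refine ⟨hc, fun v hv => ?_⟩
      have key : ∀ a b : V, 3 ≤ (nbrs H S a).card → s(u, w) = s(a, b) →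
          2 ≤ (nbrs (H.deleteEdges {s(u, w)}) S a).card := by
        intro a b ha hab
        have : (nbrs H S a).erase b ⊆ nbrs (H.deleteEdges {s(u, w)}) S a := by
          intro x hx
          simp [hab] at hx ⊢
          grind
        have := Finset.card_le_card this
        have := Finset.pred_card_le_card_erase (s := nbrs H S a) (a := b)
        omega
      by_cases hvu : v = u
      · subst hvu
        exact key _ w hu3 rfl
      by_cases hvw : v = w
      · subst hvw
        exact key _ u hw3 Sym2.eq_swap
      have : nbrs H S v = nbrs (H.deleteEdges {s(u, w)}) S v := by
        ext x
        simp
        grind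
      rw [← this]
      exact h.deg v hv
    rcases h.of_lt _ hlt hadm with hq | hq
    · exact h.not_cheap (hq.mono hlt.le)
    · exact h.not_critical (hq.mono hlt.le)
  obtain ⟨A, hA, huA, hwA, hcut⟩ := h.conn.exists_cut hu hw hnc
  have hB : Adm H (S \ A) := h.toAdm.sdiff_of_cut hA hwA hw3 hcut
  have hSS : S \ (S \ A) = A := by grind
  have hcut' : ∀ x ∈ S \ A, ∀ y ∈ S \ (S \ A), H.Adj x y → x = w ∧ y = u := by
    intro x hx y hy hxy
    have := hcut y (by grind) x hx hxy.symm
    grind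
  have hA' : Adm H A := by
    rw [← hSS]
    exact h.toAdm.sdiff_of_cut (by grind) (by grind) hu3 hcut'
  have hcard : (S \ A).card + A.card = S.card := Finset.card_sdiff_add_card_eq_card hA
  have hAp : 0 < A.card := Finset.card_pos.2 ⟨u, huA⟩
  have hBp : 0 < (S \ A).card := Finset.card_pos.2 ⟨w, hwA⟩
  rcases h.of_card_lt H A (by omega) hA' with hqA | hqA
  · rcases h.of_card_lt H (S \ A) (by omega) hB with hqB | hqB
    · obtain ⟨D, hD, hd, hc⟩ := hqA
      obtain ⟨E, hE, he, hc'⟩ := hqB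
      refine absurd ⟨D ∪ E, by grind, ?_, ?_⟩ h.not_cheap
      · intro v hv
        have h1 := hd v
        have h2 := he v
        grind
      · have := Finset.card_union_le D E
        omega
    · exact Or.inr ⟨S \ A, by grind, hwA, by grind, hcut', hB.conn, hqB⟩
  · rcases h.of_card_lt H (S \ A) (by omega) hB with hqB | hqB
    · exact Or.inl ⟨A, hA, huA, hwA, hcut, hA'.conn, hqA⟩
    · obtain ⟨D, hD, hd, hc⟩ := hqA.2 u huA
      obtain ⟨E, hE, he, hc'⟩ := hqB.2 w hwA
      refine absurd ⟨insert u (D ∪ E), by grind, ?_, ?_⟩ h.not_cheap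
      · intro v hv
        have h1 := hd v
        have h2 := he v
        grind
      · have := Finset.card_union_le D E
        have := Finset.card_insert_le u (D ∪ E)
        have := hqA.1
        have := hqB.1
        omega

theorem exists_hasNbrs {H : SimpleGraph V} {S : Finset V} {v x : V}
    (h2 : (nbrs H S v).card = 2) (hx : x ∈ S) (hvx : H.Adj v x) : ∃ y, HasNbrs H S v x y := by
  obtain ⟨y, hy, hyx, hvy, h⟩ := exists_other_nbr h2 hx hvx
  refine ⟨y, hx, hy, hyx.symm, fun z hz => ⟨h z hz, ?_⟩⟩
  rintro (rfl | rfl) <;> assumption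

theorem HasNbrs.card_eq_two {H : SimpleGraph V} {S : Finset V} {v x y : V}
    (h : HasNbrs H S v x y) : (nbrs H S v).card = 2 := by
  obtain ⟨h1, h2, h3, h4⟩ := h
  rw [Finset.card_eq_two]
  refine ⟨x, y, h3, ?_⟩
  ext z
  simp only [mem_nbrs, Finset.mem_insert, Finset.mem_singleton]
  grind

theorem Dom.expand {H H' : SimpleGraph V} {S : Finset V} {a b c u w : V}
    (hH' : ∀ x y, H'.Adj x y ↔ H.Adj x y ∨ x = u ∧ y = w ∨ x = w ∧ y = u)
    (ha : HasNbrs H S a u b) (hb : HasNbrs H S b a c) (hc : HasNbrs H S c b w)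
    {D X : Finset V} (hD : D ⊆ S) (hdom : Dom H' D X) :
    ∃ E ⊆ S, Dom H E (X ∪ {a, b, c}) ∧ E.card ≤ D.card + 1 := by
  obtain ⟨hu, hbS, hub, ha⟩ := ha
  obtain ⟨haS, hcS, hac, hb⟩ := hb
  obtain ⟨-, hw, hbw, hc⟩ := hc
  have key : ∃ e ∈ S, Dom H (insert e D) (X ∪ {a, b, c}) := by
    have hau : H.Adj a u := (ha u hu).2 (Or.inl rfl)
    have hab : H.Adj a b := (ha b hbS).2 (Or.inr rfl)
    have hbc : H.Adj b c := (hb c hcS).2 (Or.inr rfl)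
    have hcw : H.Adj c w := (hc w hw).2 (Or.inr rfl)
    have hab' := hab.symm
    have hbc' := hbc.symm
    have hau' := hau.symm
    have hcw' := hcw.symm
    have hdom' : ∀ v ∈ X, v ∈ D ∨ (∃ z ∈ D, H.Adj z v) ∨ (u ∈ D ∧ v = w) ∨ (w ∈ D ∧ v = u) := by
      intro v hv
      rcases hdom v hv with h | ⟨z, hz, hzv⟩
      · exact Or.inl h
      · rcases (hH' z v).1 hzv with h | ⟨rfl, rfl⟩ | ⟨rfl, rfl⟩
        · exact Or.inr (Or.inl ⟨z, hz, h⟩)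
        · exact Or.inr (Or.inr (Or.inl ⟨hz, rfl⟩))
        · exact Or.inr (Or.inr (Or.inr ⟨hz, rfl⟩))
    clear hdom hH' ha hb hc
    by_cases huD : u ∈ D <;> by_cases hwD : w ∈ D
    · refine ⟨b, hbS, fun v hv => ?_⟩
      have := hdom' v
      grind
    · refine ⟨c, hcS, fun v hv => ?_⟩
      have := hdom' v
      grind
    · refine ⟨a, haS, fun v hv => ?_⟩
      have := hdom' v
      grind
    · refine ⟨b, hbS, fun v hv => ?_⟩
      have := hdom' v
      grind
  obtain ⟨e, he, hdom'⟩ := key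
  exact ⟨insert e D, by grind, hdom', Finset.card_insert_le _ _⟩

theorem Dom.expand_erase {H H' : SimpleGraph V} {S X : Finset V} {a b c u w : V}
    (hH' : ∀ x y, H'.Adj x y ↔ H.Adj x y ∨ x = u ∧ y = w ∨ x = w ∧ y = u)
    (ha : HasNbrs H S a u b) (hb : HasNbrs H S b a c) (hc : HasNbrs H S c b w)
    {D : Finset V} (hD : D ⊆ S) (hdom : Dom H' D (X.erase u)) :
    ∃ E ⊆ S, Dom H E (X ∪ {a, b}) ∧ E.card ≤ D.card + 1 := by
  obtain ⟨hu, hbS, hub, ha⟩ := ha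
  obtain ⟨haS, hcS, hac, hb⟩ := hb
  obtain ⟨-, hw, hbw, hc⟩ := hc
  have key : ∃ e ∈ S, Dom H (insert e D) (X ∪ {a, b}) := by
    have hau : H.Adj a u := (ha u hu).2 (Or.inl rfl)
    have hab : H.Adj a b := (ha b hbS).2 (Or.inr rfl)
    have hbc : H.Adj b c := (hb c hcS).2 (Or.inr rfl)
    have hcw : H.Adj c w := (hc w hw).2 (Or.inr rfl)
    have hab' := hab.symm
    have hbc' := hbc.symm
    have hau' := hau.symm
    have hcw' := hcw.symm
    by_cases huD : u ∈ D
    · refine ⟨c, hcS, fun v hv => ?_⟩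
      have := hdom v
      grind
    · refine ⟨a, haS, fun v hv => ?_⟩
      have := hdom v
      grind
  obtain ⟨e, he, hdom'⟩ := key
  exact ⟨insert e D, by grind, hdom', Finset.card_insert_le _ _⟩

theorem two_le_card_nbrs_of_swap {H H' : SimpleGraph V} {S K : Finset V} {u w a : V}
    (hle : H ≤ H') (hw : w ∈ S \ K) (huw : H'.Adj u w) (huw' : ¬ H.Adj u w)
    (hK : ∀ z ∈ K, H.Adj u z → z = a) (h2 : 2 ≤ (nbrs H S u).card) :
    2 ≤ (nbrs H' (S \ K) u).card := by
  have h1 : insert w ((nbrs H S u).erase a) ⊆ nbrs H' (S \ K) u := by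
    intro x hx
    have := @hle u x
    have := hK x
    grind [mem_nbrs]
  have h3 := Finset.card_le_card h1
  rw [Finset.card_insert_of_notMem (by simp [huw'])] at h3
  have := Finset.pred_card_le_card_erase (s := nbrs H S u) (a := a)
  omega

theorem Adm.contract {H H' : SimpleGraph V} {S : Finset V} {a b c u w : V} (h : Adm H S)
    (hH' : ∀ x y, H'.Adj x y ↔ H.Adj x y ∨ x = u ∧ y = w ∨ x = w ∧ y = u)
    (ha : HasNbrs H S a u b) (hb : HasNbrs H S b a c) (hc : HasNbrs H S c b w)
    (huw : u ≠ w) (huc : u ≠ c) (hadj : ¬ H.Adj u w) : Adm H' (S \ {a, b, c}) := by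
  obtain ⟨hu, hbS, hub, ha⟩ := ha
  obtain ⟨haS, hcS, hac, hb⟩ := hb
  obtain ⟨-, hw, hbw, hc⟩ := hc
  have hau : H.Adj a u := (ha u hu).2 (Or.inl rfl)
  have hab : H.Adj a b := (ha b hbS).2 (Or.inr rfl)
  have hbc : H.Adj b c := (hb c hcS).2 (Or.inr rfl)
  have hcw : H.Adj c w := (hc w hw).2 (Or.inr rfl)
  have hne1 := hau.ne
  have hne2 := hcw.ne
  have hne3 : w ≠ a := by
    rintro rfl
    have := (ha c hcS).1 hcw.symm
    have := hbc.ne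
    grind
  have sub : {a, b, c} ⊆ S := by grind
  constructor
  · intro A hA hne hcl
    have hiff : u ∈ A ↔ w ∈ A := by
      have h1 := hcl u
      have h2 := hcl w
      grind
    obtain ⟨y, hy⟩ := hne
    by_cases huA : u ∈ A
    · have : A ∪ {a, b, c} = S := by
        refine h.conn _ (by grind) ⟨y, by grind⟩ ?_
        intro p hp q hq hpq
        by_cases hqK : q ∈ ({a, b, c} : Finset V)
        · grind
        · rcases Finset.mem_union.1 hp with hp | hp
          · exact Finset.mem_union_left _ (hcl p hp q (by grind) ((hH' p q).2 (Or.inl hpq)))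
          · clear hH' hcl
            grind
      grind
    · have : A = S := by
        refine h.conn _ (by grind) ⟨y, by grind⟩ ?_
        intro p hp q hq hpq
        have h1 := hcl p
        have h2 := hpq.symm
        grind
      grind
  · intro v hv
    have hle : H ≤ H' := fun x y hxy => (hH' x y).2 (Or.inl hxy)
    by_cases hvu : v = u
    · subst hvu
      refine two_le_card_nbrs_of_swap (w := w) (a := a) hle (by grind) (by grind) hadj ?_
        (h.deg v hu)
      intro z hz hvz
      have := hvz.symm
      grind
    by_cases hvw : v = w
    · subst hvw
      refine two_le_card_nbrs_of_swap (w := u) (a := c) hle (by grind) (by grind)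
        (fun h => hadj h.symm) ?_ (h.deg v hw)
      intro z hz hvz
      have := hvz.symm
      grind
    have : nbrs H' (S \ {a, b, c}) v = nbrs H S v := by
      ext x
      have := H.adj_comm x v
      grind [mem_nbrs]
    rw [this]
    exact h.deg v (by grind)

theorem MinCex.adj_of_chain {H : SimpleGraph V} {S : Finset V} {a b c u w : V}
    (h : MinCex H S) (ha : HasNbrs H S a u b) (hb : HasNbrs H S b a c) (hc : HasNbrs H S c b w)
    (huw : u ≠ w) (huc : u ≠ c) : H.Adj u w := by
  by_contra hadj
  obtain ⟨H', hH'⟩ : ∃ H' : SimpleGraph V,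
      ∀ x y, H'.Adj x y ↔ H.Adj x y ∨ x = u ∧ y = w ∨ x = w ∧ y = u := by
    refine ⟨H ⊔ SimpleGraph.edge u w, fun x y => ?_⟩
    simp only [SimpleGraph.sup_adj, SimpleGraph.edge_adj]
    grind
  have hadm := h.toAdm.contract hH' ha hb hc huw huc hadj
  have haS : a ∈ S := hb.1
  have hbS : b ∈ S := hc.1
  have hcS : c ∈ S := hb.2.1
  have hu : u ∈ S := ha.1
  have hw : w ∈ S := hc.2.1
  have habc : ({a, b, c} : Finset V).card = 3 := by
    have h1 : a ≠ b := ((ha.2.2.2 b hbS).2 (Or.inr rfl)).ne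
    have h2 : b ≠ c := ((hb.2.2.2 c hcS).2 (Or.inr rfl)).ne
    have h3 : a ≠ c := hb.2.2.1
    rw [Finset.card_eq_three]
    exact ⟨a, b, c, h1, h3, h2, rfl⟩
  have hsub : {a, b, c} ⊆ S := by grind
  have hcard : (S \ {a, b, c}).card + 3 = S.card := by
    rw [← habc]
    exact Finset.card_sdiff_add_card_eq_card hsub
  have hS : ∀ X, S \ {a, b, c} ⊆ X → X ∪ {a, b, c} ⊇ S := by
    intro X hX
    grind
  have hau : H.Adj u a := ((ha.2.2.2 u hu).2 (Or.inl rfl)).symm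
  have hcw : H.Adj w c := ((hc.2.2.2 w hw).2 (Or.inr rfl)).symm
  have huS' : u ∈ S \ {a, b, c} := by
    have := ha.2.2.1
    have := hau.ne
    grind
  have hwS' : w ∈ S \ {a, b, c} := by
    have := hc.2.2.1
    have := hcw.ne
    have : w ≠ a := by
      rintro rfl
      have := (ha.2.2.2 c hcS).1 hcw
      have := ((hb.2.2.2 c hcS).2 (Or.inr rfl)).ne
      grind
    grind
  rcases h.of_card_lt H' _ (by omega) hadm with ⟨D, hD, hdom, hc'⟩ | ⟨h47, hcrit⟩
  · obtain ⟨E, hE, hdomE, hcE⟩ := hdom.expand hH' ha hb hc (hD.trans Finset.sdiff_subset)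
    exact h.not_cheap ⟨E, hE, fun v hv => hdomE v (hS _ subset_rfl hv), by omega⟩
  rcases h47 with h4 | h7
  · refine h.not_critical ⟨by omega, fun v hv => ?_⟩
    have hcases : v ∈ S \ {a, b, c} ∨ v = a ∨ v = b ∨ v = c := by grind
    rcases hcases with hvS | rfl | rfl | rfl
    · obtain ⟨D, hD, hdom, hcD⟩ := hcrit v hvS
      obtain ⟨E, hE, hdomE, hcE⟩ := hdom.expand hH' ha hb hc (hD.trans Finset.sdiff_subset)
      exact ⟨E, hE, fun x hx => hdomE x (by grind), by omega⟩
    · obtain ⟨D, hD, hdom, hcD⟩ := hcrit w hwS'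
      obtain ⟨E, hE, hdomE, hcE⟩ := Dom.expand_erase (H' := H') (u := w) (w := u) (by grind)
        hc.symm hb.symm ha.symm (hD.trans Finset.sdiff_subset) hdom
      exact ⟨E, hE, fun x hx => hdomE x (by grind), by omega⟩
    · refine ⟨{u, w}, by grind, ?_, ?_⟩
      · intro x hx
        by_cases hxK : x = a ∨ x = c
        · grind
        by_contra hcon
        have hxS : x ∈ S \ {a, v, c} := by grind
        have h1 : nbrs H' (S \ {a, v, c}) x ⊆ (S \ {a, v, c}) \ {u, w, x} := by
          intro y hy
          have h2 := (mem_nbrs.1 hy)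
          have h3 := (hH' x y).1 h2.2
          have := H.adj_comm x y
          have := h2.2.ne
          grind
        have h2 := Finset.card_le_card h1
        have h3 := hadm.deg x hxS
        have h4 : ({u, w, x} : Finset V).card = 3 := by
          rw [Finset.card_eq_three]
          exact ⟨u, w, x, huw, by grind, by grind, rfl⟩
        have h5 := Finset.card_sdiff_add_card_eq_card
          (show {u, w, x} ⊆ S \ {a, v, c} by grind)
        omega
      · have := Finset.card_le_two (a := u) (b := w)
        omega
    · obtain ⟨D, hD, hdom, hcD⟩ := hcrit u huS'
      obtain ⟨E, hE, hdomE, hcE⟩ := hdom.expand_erase hH' ha hb hc (hD.trans Finset.sdiff_subset)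
      exact ⟨E, hE, fun x hx => hdomE x (by grind), by omega⟩
  · obtain ⟨D, hD, hdom, hcD⟩ := hcrit u huS'
    have hdom' : Dom H' (insert u D) (S \ {a, b, c}) := by
      intro x hx
      have := hdom x
      grind
    obtain ⟨E, hE, hdomE, hcE⟩ := hdom'.expand hH' ha hb hc
      (by grind)
    have := Finset.card_insert_le u D
    exact h.not_cheap ⟨E, hE, fun v hv => hdomE v (hS _ subset_rfl hv), by omega⟩

theorem Critical.exists_dom {H : SimpleGraph V} {S : Finset V} {v : V} (h : Critical H S)
    (hv : v ∈ S) : ∃ D ⊆ S, v ∈ D ∧ Dom H D S ∧ 3 * D.card ≤ S.card + 2 := by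
  obtain ⟨D, hD, hdom, hc⟩ := h.2 v hv
  refine ⟨insert v D, by grind, by grind, ?_, ?_⟩
  · intro x hx
    have := hdom x
    grind
  · have := Finset.card_insert_le v D
    omega

theorem MinCex.card_nbrs_of_square {H : SimpleGraph V} {S : Finset V} {u a b c : V}
    (h : MinCex H S) (ha : HasNbrs H S a u b) (hb : HasNbrs H S b a c)
    (hc : HasNbrs H S c b u) : (nbrs H S u).card = 3 := by
  have hu : u ∈ S := ha.1
  have hbS : b ∈ S := hc.1
  have haS : a ∈ S := hb.1
  have hcS : c ∈ S := hb.2.1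
  have hac : a ≠ c := hb.2.2.1
  have hub : u ≠ b := ha.2.2.1
  have hau : H.Adj a u := (ha.adj_iff hu).2 (Or.inl rfl)
  have hab : H.Adj a b := (ha.adj_iff hbS).2 (Or.inr rfl)
  have hbc : H.Adj b c := (hb.adj_iff hcS).2 (Or.inr rfl)
  have hcu : H.Adj c u := (hc.adj_iff hu).2 (Or.inr rfl)
  have habc : ({a, b, c} : Finset V).card = 3 :=
    Finset.card_eq_three.2 ⟨a, b, c, hab.ne, hac, hbc.ne, rfl⟩
  have hsub : {a, b, c} ⊆ S := by grind
  have huabc : u ∉ ({a, b, c} : Finset V) := by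
    have := hau.ne
    have := hcu.ne
    grind
  have huS : u ∈ S \ {a, b, c} := by grind
  have hcard : (S \ {a, b, c}).card + 3 = S.card := by
    rw [← habc]
    exact Finset.card_sdiff_add_card_eq_card hsub
  have hnub : ¬ H.Adj b u := by
    rw [hb.adj_iff hu]
    grind
  have hdeg := h.deg u hu
  by_contra hne
  rcases (show (nbrs H S u).card = 2 ∨ 4 ≤ (nbrs H S u).card by omega) with h2 | h4
  · obtain ⟨c', hc'⟩ := exists_hasNbrs h2 haS hau.symm
    obtain rfl : c = c' := by
      have := (hc'.adj_iff hcS).1 hcu.symm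
      grind
    have hS : {u, a, b, c} = S := by
      refine h.conn _ (by grind) ⟨u, by grind⟩ ?_
      intro p hp q hq hpq
      have h1 := ha.adj_iff hq
      have h2 := hb.adj_iff hq
      have h3 := hc.adj_iff hq
      have h4 := hc'.adj_iff hq
      clear ha hb hc hc'
      grind
    have hS4 : S.card = 4 := by
      rw [← hS, Finset.card_insert_of_notMem huabc, habc]
    refine h.not_critical ⟨Or.inl hS4, fun v hv => ?_⟩
    have key : ∃ x ∈ S, Dom H {x} (S.erase v) := by
      have hau' := hau.symm
      have hab' := hab.symm
      have hbc' := hbc.symm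
      have hcu' := hcu.symm
      clear ha hb hc hc'
      rw [← hS] at hv ⊢
      simp only [Dom, Finset.mem_singleton, exists_eq_left]
      simp only [Finset.mem_insert, Finset.mem_singleton] at hv
      rcases hv with rfl | rfl | rfl | rfl
      · exact ⟨b, by grind, by grind⟩
      · exact ⟨c, by grind, by grind⟩
      · exact ⟨u, by grind, by grind⟩
      · exact ⟨a, by grind, by grind⟩
    obtain ⟨x, hx, hdom⟩ := key
    exact ⟨{x}, by grind, hdom, by rw [Finset.card_singleton]; omega⟩
  · have hedge : ∀ x ∈ ({a, b, c} : Finset V), ∀ y ∈ S \ {a, b, c}, H.Adj x y → y = u := by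
      intro x hx y hy hxy
      have hyS : y ∈ S := by grind
      have h1 := ha.adj_iff hyS
      have h2 := hb.adj_iff hyS
      have h3 := hc.adj_iff hyS
      clear ha hb hc
      grind
    have hadm : Adm H (S \ {a, b, c}) := by
      refine h.toAdm.sdiff hsub huS hedge ?_
      have h1 : (nbrs H S u).card ≤ _ := card_nbrs_sdiff (K := {a, b, c})
      have h2 : nbrs H {a, b, c} u ⊆ {a, c} := by
        intro x hx
        have := H.adj_comm u x
        grind [mem_nbrs]
      have h3 := Finset.card_le_card h2
      have := Finset.card_le_two (a := a) (b := c)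
      omega
    have hb_dom : ∀ D : Finset V, ∀ X, Dom H D X → Dom H (insert b D) (X ∪ {a, b, c}) := by
      intro D X hD v hv
      have := hD v
      have hab' := hab.symm
      grind
    rcases h.of_card_lt H _ (by omega) hadm with ⟨D, hD, hdom, hc'⟩ | hcrit
    · refine h.not_cheap ⟨insert b D, by grind, fun v hv => hb_dom D _ hdom v (by grind), ?_⟩
      have := Finset.card_insert_le b D
      omega
    · rcases hcrit.1 with h4 | h7
      · refine h.not_critical ⟨by omega, fun v hv => ?_⟩
        by_cases hvK : v ∈ ({a, b, c} : Finset V)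
        · obtain ⟨D, hD, hdom, hcD⟩ := hcrit.2 u huS
          have key : ∃ x ∈ S, Dom H (insert x D) (S.erase v) := by
            clear hcrit hadm hedge habc hb_dom
            simp only [Finset.mem_insert, Finset.mem_singleton] at hvK
            have hau' := hau.symm
            have hbc' := hbc.symm
            have hcu' := hcu.symm
            clear ha hb hc
            rcases hvK with rfl | rfl | rfl
            · refine ⟨c, hcS, fun x hx => ?_⟩
              have := hdom x
              grind
            · refine ⟨u, hu, fun x hx => ?_⟩
              have := hdom x
              grind
            · refine ⟨a, haS, fun x hx => ?_⟩
              have := hdom x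
              grind
          obtain ⟨x, hx, hdom'⟩ := key
          refine ⟨insert x D, by grind, hdom', ?_⟩
          have := Finset.card_insert_le x D
          omega
        · obtain ⟨D, hD, hdom, hcD⟩ := hcrit.2 v (by grind)
          refine ⟨insert b D, by grind, fun x hx => hb_dom D _ hdom x (by grind), ?_⟩
          have := Finset.card_insert_le b D
          omega
      · obtain ⟨D, hD, -, hdom, hcD⟩ := hcrit.exists_dom huS
        refine h.not_cheap ⟨insert b D, by grind, fun v hv => hb_dom D _ hdom v (by grind), ?_⟩
        have := Finset.card_insert_le b D
        omega

theorem Dom.union {H : SimpleGraph V} {D E X Y : Finset V} (h : Dom H D X) (h' : Dom H E Y) :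
    Dom H (D ∪ E) (X ∪ Y) := by
  intro v hv
  have := h v
  have := h' v
  grind

theorem MinCex.not_cut_of_card_eq_five {H : SimpleGraph V} {S K E F : Finset V} {x y : V}
    (h : MinCex H S) (hK : K ⊆ S) (h5 : K.card = 5) (hy : y ∈ S \ K)
    (hcut : ∀ p ∈ K, ∀ q ∈ S \ K, H.Adj p q → p = x ∧ q = y)
    (hE : E ⊆ K) (hEK : Dom H E K) (hE2 : E.card ≤ 2)
    (hF : F ⊆ K) (hFK : Dom H F (insert y K)) (hF2 : F.card ≤ 2) :
    ¬ 3 ≤ (nbrs H S y).card := by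
  intro h3
  have hadm := h.toAdm.sdiff_of_cut hK hy h3 hcut
  have hcard := Finset.card_sdiff_add_card_eq_card hK
  rcases h.of_card_lt H _ (by omega) hadm with ⟨D, hD, hdom, hc'⟩ | hcrit
  · refine h.not_cheap ⟨D ∪ E, by grind, fun v hv => hdom.union hEK v (by grind), ?_⟩
    have := Finset.card_union_le D E
    omega
  · obtain ⟨D, hD, hdom, hcD⟩ := hcrit.2 y hy
    refine h.not_cheap ⟨D ∪ F, by grind, fun v hv => hdom.union hFK v (by grind), ?_⟩
    have := Finset.card_union_le D F
    have := hcrit.1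
    omega

theorem MinCex.not_cut_of_card_eq_six {H : SimpleGraph V} {S K E : Finset V} {x y : V}
    (h : MinCex H S) (hK : K ⊆ S) (h6 : K.card = 6) (hy : y ∈ S \ K)
    (hcut : ∀ p ∈ K, ∀ q ∈ S \ K, H.Adj p q → p = x ∧ q = y)
    (hE : E ⊆ K) (hEK : Dom H E K) (hE2 : E.card ≤ 2) : ¬ 3 ≤ (nbrs H S y).card := by
  intro h3
  have hadm := h.toAdm.sdiff_of_cut hK hy h3 hcut
  have hcard := Finset.card_sdiff_add_card_eq_card hK
  rcases h.of_card_lt H _ (by omega) hadm with ⟨D, hD, hdom, hc'⟩ | hcrit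
  · refine h.not_cheap ⟨D ∪ E, by grind, fun v hv => hdom.union hEK v (by grind), ?_⟩
    have := Finset.card_union_le D E
    omega
  · obtain ⟨D, hD, -, hdom, hcD⟩ := hcrit.exists_dom hy
    refine h.not_cheap ⟨D ∪ E, by grind, fun v hv => hdom.union hEK v (by grind), ?_⟩
    have := Finset.card_union_le D E
    have := hcrit.1
    omega

theorem exists_third_nbr_of_square {H : SimpleGraph V} {S : Finset V} {u a b c : V}
    (h3 : (nbrs H S u).card = 3) (ha : HasNbrs H S a u b) (hb : HasNbrs H S b a c)
    (hc : HasNbrs H S c b u) :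
    ∃ x ∈ S, x ∉ ({u, a, b, c} : Finset V) ∧ H.Adj u x ∧
      ∀ z ∈ S, H.Adj u z → z = a ∨ z = c ∨ z = x := by
  have hu : u ∈ S := ha.1
  have hbS : b ∈ S := hc.1
  have haS : a ∈ S := hb.1
  have hcS : c ∈ S := hb.2.1
  have hac : a ≠ c := hb.2.2.1
  have hub : u ≠ b := ha.2.2.1
  have hau : H.Adj a u := (ha.adj_iff hu).2 (Or.inl rfl)
  have hab : H.Adj a b := (ha.adj_iff hbS).2 (Or.inr rfl)
  have hbc : H.Adj b c := (hb.adj_iff hcS).2 (Or.inr rfl)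
  have hcu : H.Adj c u := (hc.adj_iff hu).2 (Or.inr rfl)
  have hua := hau.ne
  have huc := hcu.ne
  have hbu : ¬ H.Adj u b := by
    rw [H.adj_comm, hb.adj_iff hu]
    grind
  obtain ⟨x, hx⟩ : ∃ x, nbrs H S u \ {a, c} = {x} := by
    rw [← Finset.card_eq_one]
    have h1 : {a, c} ⊆ nbrs H S u := by
      intro z hz
      have := hau.symm
      have := hcu.symm
      grind [mem_nbrs]
    have h2 := Finset.card_sdiff_add_card_eq_card h1
    rw [Finset.card_pair hac] at h2
    omega
  have hxm : ∀ z, (z ∈ S ∧ H.Adj u z) ∧ (z ≠ a ∧ z ≠ c) ↔ z = x := by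
    intro z
    rw [← Finset.mem_singleton, ← hx]
    simp
  clear hx
  obtain ⟨⟨hxS, hux⟩, hxa, hxc⟩ := (hxm x).2 rfl
  have hxb : x ≠ b := by
    rintro rfl
    exact hbu hux
  have huN : ∀ z ∈ S, H.Adj u z → z = a ∨ z = c ∨ z = x := by
    intro z hz huz
    have := hxm z
    grind
  clear hxm
  have hxu := hux.ne
  exact ⟨x, hxS, by grind, hux, huN⟩

theorem MinCex.exists_large_of_square {H : SimpleGraph V} {S : Finset V} {u a b c : V}
    (h : MinCex H S) (ha : HasNbrs H S a u b) (hb : HasNbrs H S b a c)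
    (hc : HasNbrs H S c b u) :
    ∃ x ∈ S, x ∉ ({u, a, b, c} : Finset V) ∧ 3 ≤ (nbrs H S x).card ∧ H.Adj u x ∧
      ∀ z ∈ S, H.Adj u z → z = a ∨ z = c ∨ z = x := by
  obtain ⟨x, hxS, hxK, hux, huN⟩ :=
    exists_third_nbr_of_square (h.card_nbrs_of_square ha hb hc) ha hb hc
  have hu : u ∈ S := ha.1
  have hbS : b ∈ S := hc.1
  have haS : a ∈ S := hb.1
  have hcS : c ∈ S := hb.2.1
  have hac : a ≠ c := hb.2.2.1
  have hub : u ≠ b := ha.2.2.1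
  have hau : H.Adj a u := (ha.adj_iff hu).2 (Or.inl rfl)
  have hab : H.Adj a b := (ha.adj_iff hbS).2 (Or.inr rfl)
  have hbc : H.Adj b c := (hb.adj_iff hcS).2 (Or.inr rfl)
  have hcu : H.Adj c u := (hc.adj_iff hu).2 (Or.inr rfl)
  have hua := hau.ne
  have huc := hcu.ne
  have hbu : ¬ H.Adj u b := by
    rw [H.adj_comm, hb.adj_iff hu]
    grind
  simp only [Finset.mem_insert, Finset.mem_singleton, not_or] at hxK
  obtain ⟨hxu', hxa, hxb, hxc⟩ := hxK
  have hxu := hux.ne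
  by_cases hxL : 3 ≤ (nbrs H S x).card
  · exact ⟨x, hxS, by grind, hxL, hux, huN⟩
  exfalso
  have hx2 := h.deg x hxS
  obtain ⟨y, hy⟩ := exists_hasNbrs (show (nbrs H S x).card = 2 by omega) hu hux.symm
  have hyS : y ∈ S := hy.2.1
  have hxy : H.Adj x y := (hy.adj_iff hyS).2 (Or.inr rfl)
  have hxy' := hxy.ne
  have hyu : u ≠ y := hy.2.2.1
  obtain ⟨K, hK⟩ : ∃ K : Finset V, K = {u, a, b, c, x} := ⟨_, rfl⟩
  have hmK : ∀ p, p ∈ K ↔ p = u ∨ p = a ∨ p = b ∨ p = c ∨ p = x := by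
    intro p
    simp [hK]
  have hyK : y ∉ K := by
    have h1 := ha.adj_iff hxS
    have h2 := hb.adj_iff hxS
    have h3 := hc.adj_iff hxS
    have := H.adj_comm x y
    rw [hmK]
    grind
  have hcut : ∀ p ∈ K, ∀ q ∈ S \ K, H.Adj p q → p = x ∧ q = y := by
    intro p hp q hq hpq
    obtain ⟨hqS, hqK⟩ := Finset.mem_sdiff.1 hq
    rw [hmK] at hp hqK
    have h1 := ha.adj_iff hqS
    have h2 := hb.adj_iff hqS
    have h3 := hc.adj_iff hqS
    have h4 := hy.adj_iff hqS
    have h5 := huN q hqS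
    clear ha hb hc hy huN hmK
    grind
  have hK5 : K.card = 5 := by
    have := hab.ne
    have := hbc.ne
    rw [hK]
    repeat rw [Finset.card_insert_of_notMem (by simp; grind)]
    simp
  have hKS : K ⊆ S := by
    intro p hp
    rcases (hmK p).1 hp with rfl | rfl | rfl | rfl | rfl <;> assumption
  have hab' := hab.symm
  have hux' := hux.symm
  have hyL : ¬ 3 ≤ (nbrs H S y).card := by
    refine h.not_cut_of_card_eq_five (E := {u, b}) (F := {x, b}) hKS hK5 (by grind) hcut
      ?_ ?_ Finset.card_le_two ?_ ?_ Finset.card_le_two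
    · simp [Finset.insert_subset_iff, hmK]
    · intro v hv
      rcases (hmK v).1 hv with rfl | rfl | rfl | rfl | rfl
      · exact Or.inl (by simp)
      · exact Or.inr ⟨b, by simp, hab'⟩
      · exact Or.inl (by simp)
      · exact Or.inr ⟨b, by simp, hbc⟩
      · exact Or.inr ⟨u, by simp, hux⟩
    · simp [Finset.insert_subset_iff, hmK]
    · intro v hv
      rw [Finset.mem_insert, hmK] at hv
      rcases hv with rfl | rfl | rfl | rfl | rfl | rfl
      · exact Or.inr ⟨x, by simp, hxy⟩
      · exact Or.inr ⟨x, by simp, hux'⟩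
      · exact Or.inr ⟨b, by simp, hab'⟩
      · exact Or.inl (by simp)
      · exact Or.inr ⟨b, by simp, hbc⟩
      · exact Or.inl (by simp)
  have hy2 := h.deg y hyS
  obtain ⟨z, hz⟩ := exists_hasNbrs (show (nbrs H S y).card = 2 by omega) hxS hxy.symm
  have hzS : z ∈ S := hz.2.1
  have hyz : H.Adj y z := (hz.adj_iff hzS).2 (Or.inr rfl)
  have hyz' := hyz.ne
  have hzK : z ∉ insert y K := by
    have h1 := hcut z
    have := hyz.symm
    have := hz.2.2.1
    grind
  have hcut' : ∀ p ∈ insert y K, ∀ q ∈ S \ insert y K, H.Adj p q → p = y ∧ q = z := by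
    intro p hp q hq hpq
    have hqS : q ∈ S := by grind
    have h1 := hz.adj_iff hqS
    have h2 := hcut p
    have h3 := hmK x
    grind
  have hzL : ¬ 3 ≤ (nbrs H S z).card := by
    refine h.not_cut_of_card_eq_six (E := {x, b}) (by grind)
      (by rw [Finset.card_insert_of_notMem hyK, hK5]) (by grind) hcut' ?_ ?_ Finset.card_le_two
    · simp [Finset.insert_subset_iff, hmK]
    intro v hv
    rw [Finset.mem_insert, hmK] at hv
    rcases hv with rfl | rfl | rfl | rfl | rfl | rfl
    · exact Or.inr ⟨x, by simp, hxy⟩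
    · exact Or.inr ⟨x, by simp, hux'⟩
    · exact Or.inr ⟨b, by simp, hab'⟩
    · exact Or.inl (by simp)
    · exact Or.inr ⟨b, by simp, hbc⟩
    · exact Or.inl (by simp)
  have hz2 := h.deg z hzS
  obtain ⟨t, ht⟩ := exists_hasNbrs (show (nbrs H S z).card = 2 by omega) hyS hyz.symm
  have htS : t ∈ S := ht.2.1
  have hzt : H.Adj z t := (ht.adj_iff htS).2 (Or.inr rfl)
  have htK : t ∉ insert y K := by
    have h1 := hcut' t
    have := hzt.symm
    have := ht.2.2.1
    grind
  have huK : u ∈ K := (hmK u).2 (Or.inl rfl)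
  have hut := huN t htS (h.adj_of_chain hy hz ht (by grind) (by grind))
  refine htK (Finset.mem_insert_of_mem ((hmK t).2 ?_))
  tauto

/-- `y` is the attaching vertex of a four-cycle whose other three vertices have degree two. -/
def SquareRoot (H : SimpleGraph V) (S : Finset V) (y : V) : Prop :=
  ∃ a b c, HasNbrs H S a y b ∧ HasNbrs H S b a c ∧ HasNbrs H S c b y

/-- `D` pays for `T`: it dominates all vertices of `T` without outside neighbours, and in every
union `T'` of components of `T` there is room for `D ∩ T'` and for all edges leaving `T'`. These
edges end in vertices of degree at least three that are not roots of squares. -/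
structure Paid (H : SimpleGraph V) (S T D : Finset V) : Prop where
  subset : T ⊆ S
  subset_left : D ⊆ T
  dom : ∀ t ∈ T, t ∈ D ∨ (∃ d ∈ D, H.Adj d t) ∨ ∃ y ∈ S \ T, H.Adj t y
  card_le : ∀ T' ⊆ T, (∀ x ∈ T', ∀ y ∈ T, H.Adj x y → y ∈ T') →
    5 * (D ∩ T').card + ∑ w ∈ S \ T, (nbrs H T' w).card ≤ 2 * T'.card
  large : ∀ t ∈ T, ∀ y ∈ S \ T, H.Adj t y → 3 ≤ (nbrs H S y).card ∧ ¬ SquareRoot H S y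

theorem paid_empty (H : SimpleGraph V) (S : Finset V) : Paid H S ∅ ∅ where
  subset := by simp
  subset_left := by simp
  dom := by simp
  card_le := by
    intro T' hT' _
    obtain rfl := Finset.subset_empty.1 hT'
    simp [nbrs]
  large := by simp

theorem Paid.extend {H : SimpleGraph V} {S T D A E : Finset V} (h : Paid H S T D) (hAS : A ⊆ S)
    (hA : Conn H A) (hAT : ∀ x ∈ A, ∀ y ∈ T, H.Adj x y → y ∈ A) (hEA : E ⊆ A)
    (hdom : ∀ t ∈ A, t ∈ E ∨ (∃ d ∈ E, H.Adj d t) ∨ ∃ y ∈ S \ (T ∪ A), H.Adj t y)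
    (hcard : 5 * E.card + ∑ w ∈ S \ (T ∪ A), (nbrs H A w).card ≤ 2 * A.card)
    (hlarge : ∀ t ∈ A, ∀ y ∈ S \ (T ∪ A), H.Adj t y →
      3 ≤ (nbrs H S y).card ∧ ¬ SquareRoot H S y) :
    Paid H S (T ∪ A) (D \ A ∪ E) := by
  have hTA : ∀ x ∈ T, ∀ y ∈ A, H.Adj x y → x ∈ A := fun x hx y hy hxy => hAT y hy x hx hxy.symm
  have hDT := h.subset_left
  refine ⟨Finset.union_subset h.subset hAS, ?_, ?_, ?_, ?_⟩
  · intro x hx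
    simp only [Finset.mem_union, Finset.mem_sdiff] at hx ⊢
    rcases hx with hx | hx
    · exact Or.inl (hDT hx.1)
    · exact Or.inr (hEA hx)
  · intro t ht
    by_cases htA : t ∈ A
    · rcases hdom t htA with h1 | ⟨d, hd, hdt⟩ | h1
      · exact Or.inl (Finset.mem_union_right _ h1)
      · exact Or.inr (Or.inl ⟨d, Finset.mem_union_right _ hd, hdt⟩)
      · exact Or.inr (Or.inr h1)
    have htT : t ∈ T := by grind
    rcases h.dom t htT with h1 | ⟨d, hd, hdt⟩ | ⟨y, hy, hty⟩
    · exact Or.inl (by grind)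
    · refine Or.inr (Or.inl ⟨d, ?_, hdt⟩)
      have := hTA t htT d
      have := hdt.symm
      grind
    · refine Or.inr (Or.inr ⟨y, ?_, hty⟩)
      have := hTA t htT y
      grind
  · intro T' hT' hcl
    have h1 := h.card_le (T' \ A) (by grind) (by
      intro x hx y hy hxy
      have := hTA x
      have := hcl x
      have := hTA x
      grind)
    have hsub : S \ (T ∪ A) ⊆ S \ T := by grind
    rcases (T' ∩ A).eq_empty_or_nonempty with h0 | h0
    · have hT'A : T' \ A = T' := by
        rw [Finset.sdiff_eq_self_iff_disjoint, Finset.disjoint_iff_inter_eq_empty, h0]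
      rw [hT'A] at h1
      have h2 := Finset.sum_le_sum_of_subset (f := fun w => (nbrs H T' w).card) hsub
      have h3 : (D \ A ∪ E) ∩ T' ⊆ D ∩ T' := by
        intro x hx
        have : x ∉ T' ∩ A := by simp [h0]
        grind
      have h4 := Finset.card_le_card h3
      omega
    · have hAT' : T' ∩ A = A := by
        refine hA _ Finset.inter_subset_right h0 ?_
        intro a ha b hb hab
        have := hcl a
        grind
      have h2 := Finset.sum_le_sum_of_subset (f := fun w => (nbrs H (T' \ A) w).card) hsub
      have h3 : (D \ A ∪ E) ∩ T' ⊆ D ∩ (T' \ A) ∪ E := by grind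
      have h4 := (Finset.card_le_card h3).trans (Finset.card_union_le _ _)
      have h5 : ∑ w ∈ S \ (T ∪ A), (nbrs H T' w).card ≤
          ∑ w ∈ S \ (T ∪ A), (nbrs H (T' \ A) w).card + ∑ w ∈ S \ (T ∪ A), (nbrs H A w).card := by
        rw [← Finset.sum_add_distrib]
        refine Finset.sum_le_sum fun w _ => ?_
        refine (Finset.card_le_card ?_).trans (Finset.card_union_le _ _)
        intro x hx
        simp only [Finset.mem_union, mem_nbrs, Finset.mem_sdiff] at hx ⊢
        tauto
      have h6 := Finset.card_sdiff_add_card_inter T' A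
      rw [hAT'] at h6
      omega
  · intro t ht y hy hty
    by_cases htA : t ∈ A
    · exact hlarge t htA y hy hty
    · exact h.large t (by grind) y (by grind) hty

theorem MinCex.square_of_squareRoot {H : SimpleGraph V} {S : Finset V} {s y : V}
    (h : MinCex H S) (hy : SquareRoot H S y) (hs : s ∈ S) (hys : H.Adj y s)
    (hs2 : (nbrs H S s).card = 2) :
    ∃ b c, HasNbrs H S s y b ∧ HasNbrs H S b s c ∧ HasNbrs H S c b y := by
  obtain ⟨a, b, c, ha, hb, hc⟩ := hy
  obtain ⟨x, hx, hxK, hx3, hyx, hyN⟩ := h.exists_large_of_square ha hb hc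
  rcases hyN s hs hys with rfl | rfl | rfl
  · exact ⟨b, c, ha, hb, hc⟩
  · exact ⟨b, a, hc.symm, hb.symm, ha.symm⟩
  · omega

/-- `T` is a largest set that some `D` pays for. -/
def MaxPaid (H : SimpleGraph V) (S T : Finset V) : Prop :=
  (∃ D, Paid H S T D) ∧ ∀ T' D', Paid H S T' D' → T'.card ≤ T.card

theorem exists_maxPaid (H : SimpleGraph V) (S : Finset V) : ∃ T, MaxPaid H S T := by
  classical
  have hne : (S.powerset.filter fun T => ∃ D, Paid H S T D).Nonempty :=
    ⟨∅, by simpa using ⟨∅, paid_empty H S⟩⟩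
  obtain ⟨T, hT, hmax⟩ := Finset.exists_max_image _ Finset.card hne
  refine ⟨T, (Finset.mem_filter.1 hT).2, fun T' D' h => hmax T' ?_⟩
  exact Finset.mem_filter.2 ⟨Finset.mem_powerset.2 h.subset, D', h⟩

theorem MaxPaid.subset_of {H : SimpleGraph V} {S T A E : Finset V} (h : MaxPaid H S T)
    (hAS : A ⊆ S) (hA : Conn H A) (hAT : ∀ x ∈ A, ∀ y ∈ T, H.Adj x y → y ∈ A) (hEA : E ⊆ A)
    (hdom : ∀ t ∈ A, t ∈ E ∨ (∃ d ∈ E, H.Adj d t) ∨ ∃ y ∈ S \ (T ∪ A), H.Adj t y)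
    (hcard : 5 * E.card + ∑ w ∈ S \ (T ∪ A), (nbrs H A w).card ≤ 2 * A.card)
    (hlarge : ∀ t ∈ A, ∀ y ∈ S \ (T ∪ A), H.Adj t y →
      3 ≤ (nbrs H S y).card ∧ ¬ SquareRoot H S y) : A ⊆ T := by
  obtain ⟨⟨D, hD⟩, hmax⟩ := h
  have := hmax _ _ (hD.extend hAS hA hAT hEA hdom hcard hlarge)
  exact Finset.union_eq_left.1 (Finset.eq_of_subset_of_card_le Finset.subset_union_left this).symm

theorem Satellite.not_squareRoot {H : SimpleGraph V} {S A : Finset V} {u w : V}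
    (hA : Satellite H S A u w) (h : MinCex H S) (huw : H.Adj u w)
    (hu3 : 3 ≤ (nbrs H S u).card) : ¬ SquareRoot H S w := by
  rintro ⟨a, b, c, ha, hb, hc⟩
  obtain ⟨x, hx, hxK, hx3, hwx, hwN⟩ := h.exists_large_of_square ha hb hc
  have hu : u ∈ A := hA.mem
  have huS : u ∈ S := hA.subset hu
  obtain ⟨hwS, hwA⟩ := Finset.mem_sdiff.1 hA.mem_sdiff
  have hua : u ≠ a := by
    rintro rfl
    have := ha.card_eq_two
    omega
  have hub : u ≠ b := by
    rintro rfl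
    have := hb.card_eq_two
    omega
  have huc : u ≠ c := by
    rintro rfl
    have := hc.card_eq_two
    omega
  have hux : u = x := by
    have := hwN u huS huw.symm
    tauto
  subst hux
  have haS : a ∈ S := hb.1
  have hbS : b ∈ S := hc.1
  have hcS : c ∈ S := hb.2.1
  have haw : H.Adj a w := (ha.adj_iff hwS).2 (Or.inl rfl)
  have hab : H.Adj a b := (ha.adj_iff hbS).2 (Or.inr rfl)
  have hbc : H.Adj b c := (hb.adj_iff hcS).2 (Or.inr rfl)
  have hcw : H.Adj c w := (hc.adj_iff hwS).2 (Or.inr rfl)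
  have hcut := hA.cut
  have haA : a ∉ A := fun h' => hua (hcut a h' w hA.mem_sdiff haw).1.symm
  have hcA : c ∉ A := fun h' => huc (hcut c h' w hA.mem_sdiff hcw).1.symm
  have hbA : b ∉ A := fun h' => hub (hcut b h' a (by simp [haS, haA]) hab.symm).1.symm
  have hbw : b ≠ w := ha.2.2.1.symm
  have hac : a ≠ c := hb.2.2.1
  obtain ⟨E, hEA, hE, hcard⟩ := hA.critical.2 u hu
  have hS : A ∪ {w, a, b, c} = S := by
    refine h.conn _ ?_ ⟨u, by simp [hu]⟩ ?_
    · refine Finset.union_subset hA.subset ?_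
      simp [Finset.insert_subset_iff, *]
    · intro p hp q hq hpq
      simp only [Finset.mem_union, Finset.mem_insert, Finset.mem_singleton] at hp ⊢
      rcases hp with hp | rfl | rfl | rfl | rfl
      · by_cases hqA : q ∈ A
        · exact Or.inl hqA
        · have := hcut p hp q (by simp [hq, hqA]) hpq
          tauto
      · rcases hwN q hq hpq with rfl | rfl | rfl <;> tauto
      · rcases (ha.adj_iff hq).1 hpq with rfl | rfl <;> tauto
      · rcases (hb.adj_iff hq).1 hpq with rfl | rfl <;> tauto
      · rcases (hc.adj_iff hq).1 hpq with rfl | rfl <;> tauto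
  have hScard : S.card = A.card + 4 := by
    rw [← hS, Finset.card_union_of_disjoint]
    · have := haw.ne
      have := hcw.ne
      have := hab.ne
      have := hbc.ne
      repeat rw [Finset.card_insert_of_notMem (by simp; tauto)]
      simp
    · simp [*]
  refine h.not_cheap ⟨E ∪ {w, b}, ?_, ?_, ?_⟩
  · refine Finset.union_subset (hEA.trans hA.subset) ?_
    simp [Finset.insert_subset_iff, *]
  · intro v hv
    rw [← hS] at hv
    simp only [Finset.mem_union, Finset.mem_insert, Finset.mem_singleton] at hv
    rcases hv with hv | rfl | rfl | rfl | rfl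
    · by_cases hvu : v = u
      · subst hvu
        exact Or.inr ⟨w, by simp, huw.symm⟩
      · rcases hE v (Finset.mem_erase.2 ⟨hvu, hv⟩) with h' | ⟨d, hd, hdv⟩
        · exact Or.inl (by simp [h'])
        · exact Or.inr ⟨d, by simp [hd], hdv⟩
    · exact Or.inl (by simp)
    · exact Or.inr ⟨b, by simp, hab.symm⟩
    · exact Or.inl (by simp)
    · exact Or.inr ⟨b, by simp, hbc⟩
  · have h1 := Finset.card_union_le E {w, b}
    have h2 := Finset.card_le_two (a := w) (b := b)
    have := hA.critical.1
    omega

theorem MaxPaid.false_of_satellite {H : SimpleGraph V} {S T A : Finset V} {u w : V}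
    (hT : MaxPaid H S T) (h : MinCex H S) (hA : Satellite H S A u w) (huw : H.Adj u w)
    (hu3 : 3 ≤ (nbrs H S u).card) (hw3 : 3 ≤ (nbrs H S w).card) (hu : u ∉ T) (hw : w ∉ T) :
    False := by
  obtain ⟨hwS, hwA⟩ := Finset.mem_sdiff.1 hA.mem_sdiff
  obtain ⟨E, hEA, hE, hcard⟩ := hA.critical.2 u hA.mem
  have hTS : T ⊆ S := by
    obtain ⟨⟨D, hD⟩, -⟩ := hT
    exact hD.subset
  refine hu (hT.subset_of (E := E) hA.subset hA.conn ?_ hEA ?_ ?_ ?_ hA.mem)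
  · intro x hx y hy hxy
    by_contra hyA
    obtain ⟨-, rfl⟩ := hA.cut x hx y (Finset.mem_sdiff.2 ⟨hTS hy, hyA⟩) hxy
    exact hw hy
  · intro t ht
    by_cases htu : t = u
    · subst htu
      exact Or.inr (Or.inr ⟨w, by simp [hwS, hw, hwA], huw⟩)
    · rcases hE t (Finset.mem_erase.2 ⟨htu, ht⟩) with h' | h'
      · exact Or.inl h'
      · exact Or.inr (Or.inl h')
  · rw [sum_card_nbrs_comm]
    have h1 : ∑ x ∈ A, (nbrs H (S \ (T ∪ A)) x).card ≤ ∑ x ∈ A, if x = u then 1 else 0 := by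
      refine Finset.sum_le_sum fun x hx => ?_
      have h2 : nbrs H (S \ (T ∪ A)) x ⊆ if x = u then {w} else ∅ := by
        intro y hy
        have := hA.cut x hx y
        grind [mem_nbrs]
      refine (Finset.card_le_card h2).trans ?_
      split_ifs <;> simp
    rw [Finset.sum_ite_eq' A u] at h1
    have h3 := hA.critical.1
    rw [if_pos hA.mem] at h1
    omega
  · intro t ht y hy hty
    obtain ⟨-, rfl⟩ := hA.cut t ht y (by grind) hty
    exact ⟨hw3, hA.not_squareRoot h huw hu3⟩

theorem MaxPaid.not_adj_of_large {H : SimpleGraph V} {S T : Finset V} {u w : V}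
    (hT : MaxPaid H S T) (h : MinCex H S) (hu : u ∈ S \ T) (hw : w ∈ S \ T)
    (hu3 : 3 ≤ (nbrs H S u).card) (hw3 : 3 ≤ (nbrs H S w).card) : ¬ H.Adj u w := by
  intro huw
  rw [Finset.mem_sdiff] at hu hw
  rcases h.satellite hu.1 hw.1 hu3 hw3 huw with ⟨A, hA⟩ | ⟨A, hA⟩
  · exact hT.false_of_satellite h hA huw hu3 hw3 hu.2 hw.2
  · exact hT.false_of_satellite h hA huw.symm hw3 hu3 hw.2 hu.2

theorem HasNbrs.eq_of_eq_left {H : SimpleGraph V} {S : Finset V} {v x y z : V}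
    (h : HasNbrs H S v x y) (h' : HasNbrs H S v x z) : y = z := by
  have h1 := h.adj_iff h'.2.1
  have h2 := h'.adj_iff h'.2.1
  have h3 := h'.2.2.1
  tauto

theorem MaxPaid.notMem_of_adj {H : SimpleGraph V} {S T : Finset V} {s y : V}
    (hT : MaxPaid H S T) (hs : s ∈ S) (hsT : s ∉ T) (hs2 : (nbrs H S s).card = 2)
    (hsy : H.Adj s y) : y ∉ T := by
  obtain ⟨⟨D, hD⟩, -⟩ := hT
  intro hy
  have := (hD.large y hy s (Finset.mem_sdiff.2 ⟨hs, hsT⟩) hsy.symm).1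
  omega

theorem MaxPaid.false_of_large_of_large {H : SimpleGraph V} {S T : Finset V} {s p q : V}
    (hT : MaxPaid H S T) (h : MinCex H S) (hs : s ∈ S) (hsT : s ∉ T) (hn : HasNbrs H S s p q)
    (hp : 3 ≤ (nbrs H S p).card) (hq : 3 ≤ (nbrs H S q).card) : False := by
  have hs2 := hn.card_eq_two
  have hroot : ∀ p q, HasNbrs H S s p q → 3 ≤ (nbrs H S q).card → ¬ SquareRoot H S p := by
    intro p q hn hq hp
    obtain ⟨b, c, h1, h2, -⟩ :=
      h.square_of_squareRoot hp hs ((hn.adj_iff hn.1).2 (Or.inl rfl)).symm hs2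
    obtain rfl := hn.eq_of_eq_left h1
    have := h2.card_eq_two
    omega
  have hp' : H.Adj s p := (hn.adj_iff hn.1).2 (Or.inl rfl)
  have hpT := hT.notMem_of_adj hs hsT hs2 hp'
  refine hsT (hT.subset_of (A := {s}) (E := ∅) (by simpa) (conn_singleton H s) ?_ (by simp)
    ?_ ?_ ?_ (Finset.mem_singleton_self s))
  · intro x hx y hy hxy
    rw [Finset.mem_singleton] at hx
    subst hx
    exact absurd hy (hT.notMem_of_adj hs hsT hs2 hxy)
  · intro t ht
    rw [Finset.mem_singleton] at ht
    subst ht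
    exact Or.inr (Or.inr ⟨p, by simp [hn.1, hpT, hp'.ne'], hp'⟩)
  · rw [sum_card_nbrs_comm, Finset.sum_singleton]
    have h1 : nbrs H (S \ (T ∪ {s})) s ⊆ nbrs H S s := by
      intro x
      simp only [mem_nbrs, Finset.mem_sdiff]
      tauto
    have := Finset.card_le_card h1
    simp only [Finset.card_empty, Finset.card_singleton]
    omega
  · intro t ht y hy hty
    rw [Finset.mem_singleton] at ht
    subst ht
    rcases (hn.adj_iff (Finset.mem_sdiff.1 hy).1).1 hty with rfl | rfl
    · exact ⟨hp, hroot _ _ hn hq⟩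
    · exact ⟨hq, hroot _ _ hn.symm hp⟩

theorem MaxPaid.false_of_pair {H : SimpleGraph V} {S T : Finset V} {s s' p q : V}
    (hT : MaxPaid H S T) (h : MinCex H S) (hsT : s ∉ T) (hn : HasNbrs H S s p s')
    (hn' : HasNbrs H S s' s q) (hp : 3 ≤ (nbrs H S p).card) (hq : 3 ≤ (nbrs H S q).card) :
    False := by
  have hs : s ∈ S := hn'.1
  have hs' : s' ∈ S := hn.2.1
  have hs2 := hn.card_eq_two
  have hs2' := hn'.card_eq_two
  have hss' : H.Adj s s' := (hn.adj_iff hs').2 (Or.inr rfl)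
  have hsT' : s' ∉ T := hT.notMem_of_adj hs hsT hs2 hss'
  have hroot : ∀ s s' p q, HasNbrs H S s p s' → HasNbrs H S s' s q →
      3 ≤ (nbrs H S q).card → ¬ SquareRoot H S p := by
    intro s s' p q hn hn' hq hp
    obtain ⟨b, c, h1, h2, h3⟩ := h.square_of_squareRoot hp hn'.1
      ((hn.adj_iff hn.1).2 (Or.inl rfl)).symm hn.card_eq_two
    obtain rfl := hn.eq_of_eq_left h1
    obtain rfl := hn'.eq_of_eq_left h2
    have := h3.card_eq_two
    omega
  have hsp : H.Adj s p := (hn.adj_iff hn.1).2 (Or.inl rfl)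
  have hsq : H.Adj s' q := (hn'.adj_iff hn'.2.1).2 (Or.inr rfl)
  have hpT := hT.notMem_of_adj hs hsT hs2 hsp
  have hqT := hT.notMem_of_adj hs' hsT' hs2' hsq
  have hps' : p ≠ s' := hn.2.2.1
  have hqs : s ≠ q := hn'.2.2.1
  refine hsT (hT.subset_of (A := {s, s'}) (E := ∅) ?_ ?_ ?_ (by simp) ?_ ?_ ?_
    (Finset.mem_insert_self s _))
  · simp [Finset.insert_subset_iff, hs, hs']
  · intro A hA hne hcl
    have h1 := hcl s
    have h2 := hcl s'
    have := hss'.symm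
    obtain ⟨x, hx⟩ := hne
    have hx' := hA hx
    refine hA.antisymm ?_
    simp only [Finset.mem_insert, Finset.mem_singleton] at h1 h2 hx'
    simp only [Finset.insert_subset_iff, Finset.singleton_subset_iff]
    rcases hx' with rfl | rfl
    · exact ⟨hx, h1 hx _ (Or.inr rfl) hss'⟩
    · exact ⟨h2 hx _ (Or.inl rfl) this, hx⟩
  · intro x hx y hy hxy
    rw [Finset.mem_insert, Finset.mem_singleton] at hx
    rcases hx with rfl | rfl
    · exact absurd hy (hT.notMem_of_adj hs hsT hs2 hxy)
    · exact absurd hy (hT.notMem_of_adj hs' hsT' hs2' hxy)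
  · intro t ht
    rw [Finset.mem_insert, Finset.mem_singleton] at ht
    rcases ht with rfl | rfl
    · exact Or.inr (Or.inr ⟨p, by simp [hn.1, hpT, hsp.ne', hps'], hsp⟩)
    · exact Or.inr (Or.inr ⟨q, by simp [hn'.2.1, hqT, hsq.ne', hqs.symm], hsq⟩)
  · rw [sum_card_nbrs_comm, Finset.sum_pair hss'.ne, Finset.card_pair hss'.ne]
    have h1 : nbrs H (S \ (T ∪ {s, s'})) s ⊆ {p} := by
      intro x hx
      simp only [mem_nbrs, Finset.mem_sdiff, Finset.mem_union, Finset.mem_insert,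
        Finset.mem_singleton] at hx ⊢
      have := hn.adj_iff hx.1.1
      tauto
    have h2 : nbrs H (S \ (T ∪ {s, s'})) s' ⊆ {q} := by
      intro x hx
      simp only [mem_nbrs, Finset.mem_sdiff, Finset.mem_union, Finset.mem_insert,
        Finset.mem_singleton] at hx ⊢
      have := hn'.adj_iff hx.1.1
      tauto
    have h3 := Finset.card_le_card h1
    have h4 := Finset.card_le_card h2
    rw [Finset.card_singleton] at h3 h4
    rw [Finset.card_empty]
    omega
  · intro t ht y hy hty
    simp only [Finset.mem_sdiff, Finset.mem_union, Finset.mem_insert,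
        Finset.mem_singleton] at ht hy
    rcases ht with rfl | rfl
    · rcases (hn.adj_iff hy.1).1 hty with rfl | rfl
      · exact ⟨hp, hroot _ _ _ _ hn hn' hq⟩
      · tauto
    · rcases (hn'.adj_iff hy.1).1 hty with rfl | rfl
      · tauto
      · exact ⟨hq, hroot _ _ _ _ hn'.symm hn.symm hp⟩

theorem card_quadruple {u a b c : V} (hua : u ≠ a) (hub : u ≠ b) (huc : u ≠ c) (hab : a ≠ b)
    (hac : a ≠ c) (hbc : b ≠ c) : ({u, a, b, c} : Finset V).card = 4 := by
  simp [*]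

theorem conn_path {H : SimpleGraph V} {u a b c : V} (hua : H.Adj u a) (hab : H.Adj a b)
    (hbc : H.Adj b c) : Conn H {u, a, b, c} := by
  intro B hB hne hcl
  obtain ⟨x, hx⟩ := hne
  refine hB.antisymm ?_
  have hxA := hB hx
  simp only [Finset.mem_insert, Finset.mem_singleton] at hxA hcl
  have e1 : u ∈ B ↔ a ∈ B :=
    ⟨fun h => hcl u h a (by tauto) hua, fun h => hcl a h u (by tauto) hua.symm⟩
  have e2 : a ∈ B ↔ b ∈ B :=
    ⟨fun h => hcl a h b (by tauto) hab, fun h => hcl b h a (by tauto) hab.symm⟩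
  have e3 : b ∈ B ↔ c ∈ B :=
    ⟨fun h => hcl b h c (by tauto) hbc, fun h => hcl c h b (by tauto) hbc.symm⟩
  have haB : a ∈ B := by
    rcases hxA with rfl | rfl | rfl | rfl <;> tauto
  simp only [Finset.insert_subset_iff, Finset.singleton_subset_iff]
  tauto

theorem MaxPaid.false_of_loop {H : SimpleGraph V} {S T : Finset V} {u a b c w : V}
    (hT : MaxPaid H S T) (h : MinCex H S) (haT : a ∉ T) (hu : HasNbrs H S u w a)
    (ha : HasNbrs H S a u b) (hb : HasNbrs H S b a c) (hc : HasNbrs H S c b w)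
    (hw : 3 ≤ (nbrs H S w).card) : False := by
  have huS : u ∈ S := ha.1
  have haS : a ∈ S := hb.1
  have hbS : b ∈ S := hc.1
  have hcS : c ∈ S := hb.2.1
  have hwS : w ∈ S := hc.2.1
  have huw : H.Adj u w := (hu.adj_iff hwS).2 (Or.inl rfl)
  have hua : H.Adj u a := (hu.adj_iff haS).2 (Or.inr rfl)
  have hab : H.Adj a b := (ha.adj_iff hbS).2 (Or.inr rfl)
  have hbc : H.Adj b c := (hb.adj_iff hcS).2 (Or.inr rfl)
  have hcw : H.Adj c w := (hc.adj_iff hwS).2 (Or.inr rfl)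
  have huT := hT.notMem_of_adj haS haT ha.card_eq_two hua.symm
  have hbT := hT.notMem_of_adj haS haT ha.card_eq_two hab
  have hcT := hT.notMem_of_adj hbS hbT hb.card_eq_two hbc
  have hwT := hT.notMem_of_adj hcS hcT hc.card_eq_two hcw
  have hwa : w ≠ a := hu.2.2.1
  have hub : u ≠ b := ha.2.2.1
  have hac : a ≠ c := hb.2.2.1
  have hbw : b ≠ w := hc.2.2.1
  have huc : u ≠ c := by
    rintro rfl
    have := (ha.symm.adj_iff huS).1 hua.symm
    have := (hc.adj_iff haS).1 hua
    have := hab.ne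
    tauto
  obtain ⟨A, hA⟩ : ∃ A : Finset V, A = {u, a, b, c} := ⟨_, rfl⟩
  have hmA : ∀ x, x ∈ A ↔ x = u ∨ x = a ∨ x = b ∨ x = c := by
    intro x
    simp [hA]
  have h4 : A.card = 4 := hA ▸ card_quadruple hua.ne hub huc hab.ne hac hbc.ne
  have hwA : w ∉ A := by
    have := huw.ne'
    have := hcw.ne'
    have := hbw.symm
    rw [hmA]
    tauto
  have hcut : ∀ x ∈ A, ∀ y ∈ S \ A, H.Adj x y → (x = u ∨ x = c) ∧ y = w := by
    intro x hx y hy hxy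
    rw [Finset.mem_sdiff, hmA] at hy
    obtain ⟨hyS, hyA⟩ := hy
    rcases (hmA x).1 hx with rfl | rfl | rfl | rfl
    · have := (hu.adj_iff hyS).1 hxy
      tauto
    · have := (ha.adj_iff hyS).1 hxy
      tauto
    · have := (hb.adj_iff hyS).1 hxy
      tauto
    · have := (hc.adj_iff hyS).1 hxy
      tauto
  have hAT : ∀ x ∈ A, x ∉ T := by
    intro x hx
    rcases (hmA x).1 hx with rfl | rfl | rfl | rfl <;> assumption
  have hTS : T ⊆ S := by
    obtain ⟨⟨D, hD⟩, -⟩ := hT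
    exact hD.subset
  have huA : u ∈ A := (hmA u).2 (Or.inl rfl)
  have hbA : b ∈ A := (hmA b).2 (by tauto)
  have hwX : w ∈ S \ (T ∪ A) := by simp [hwS, hwT, hwA]
  refine huT (hT.subset_of (A := A) (E := {b}) ?_ ?_ ?_ (by simpa) ?_ ?_ ?_ huA)
  · intro x hx
    rcases (hmA x).1 hx with rfl | rfl | rfl | rfl <;> assumption
  · exact hA ▸ conn_path hua hab hbc
  · intro x hx y hy hxy
    by_contra hyA
    have := (hcut x hx y (by simp [hTS hy, hyA]) hxy).2
    subst this
    exact hwT hy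
  · intro t ht
    rcases (hmA t).1 ht with rfl | rfl | rfl | rfl
    · exact Or.inr (Or.inr ⟨w, hwX, huw⟩)
    · exact Or.inr (Or.inl ⟨b, by simp, hab.symm⟩)
    · exact Or.inl (by simp)
    · exact Or.inr (Or.inr ⟨w, hwX, hcw⟩)
  · rw [h4, Finset.card_singleton]
    have h1 : ∑ v ∈ S \ (T ∪ A), (nbrs H A v).card ≤ ∑ v ∈ S \ (T ∪ A), if v = w then 2 else 0 := by
      refine Finset.sum_le_sum fun v hv => ?_
      have h2 : nbrs H A v ⊆ if v = w then {u, c} else ∅ := by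
        intro y hy
        rw [mem_nbrs] at hy
        obtain ⟨h5, rfl⟩ := hcut y hy.1 v (by grind) hy.2.symm
        simpa using h5
      refine (Finset.card_le_card h2).trans ?_
      split_ifs
      · exact Finset.card_le_two
      · simp
    rw [Finset.sum_ite_eq', if_pos hwX] at h1
    omega
  · intro t ht y hy hty
    obtain ⟨-, rfl⟩ := hcut t ht y (by grind) hty
    refine ⟨hw, fun hy => ?_⟩
    obtain ⟨b', c', h1, h2, h3⟩ := h.square_of_squareRoot hy huS huw.symm hu.card_eq_two
    obtain rfl := hu.eq_of_eq_left h1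
    obtain rfl := ha.eq_of_eq_left h2
    have := hb.eq_of_eq_left h3
    exact hcw.ne this

theorem MinCex.false_of_triangle {H : SimpleGraph V} {S : Finset V} {a b c : V}
    (h : MinCex H S) (ha : HasNbrs H S a c b) (hb : HasNbrs H S b a c) (hc : HasNbrs H S c b a) :
    False := by
  have haS : a ∈ S := hb.1
  have hbS : b ∈ S := hc.1
  have hcS : c ∈ S := hb.2.1
  have hba : H.Adj b a := (hb.adj_iff haS).2 (Or.inl rfl)
  have hbc : H.Adj b c := (hb.adj_iff hcS).2 (Or.inr rfl)
  have hac : a ≠ c := hb.2.2.1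
  have hS : {a, b, c} = S := by
    refine h.conn _ ?_ ⟨a, by simp⟩ ?_
    · simp [Finset.insert_subset_iff, *]
    · intro x hx y hy hxy
      simp only [Finset.mem_insert, Finset.mem_singleton] at hx ⊢
      rcases hx with rfl | rfl | rfl
      · rcases (ha.adj_iff hy).1 hxy with rfl | rfl <;> tauto
      · rcases (hb.adj_iff hy).1 hxy with rfl | rfl <;> tauto
      · rcases (hc.adj_iff hy).1 hxy with rfl | rfl <;> tauto
  refine h.not_cheap ⟨{b}, by simpa, ?_, ?_⟩
  · intro v hv
    rw [← hS] at hv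
    simp only [Finset.mem_insert, Finset.mem_singleton] at hv
    rcases hv with rfl | rfl | rfl
    · exact Or.inr ⟨b, by simp, hba⟩
    · exact Or.inl (by simp)
    · exact Or.inr ⟨b, by simp, hbc⟩
  · have : S.card = 3 := by
      rw [← hS, Finset.card_eq_three]
      exact ⟨a, b, c, hba.ne', hac, hbc.ne, rfl⟩
    rw [this]
    simp

theorem MinCex.false_of_pentagon {H : SimpleGraph V} {S : Finset V} {a b c u w : V}
    (h : MinCex H S) (hu : HasNbrs H S u w a) (ha : HasNbrs H S a u b) (hb : HasNbrs H S b a c)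
    (hc : HasNbrs H S c b w) (hw : HasNbrs H S w c u) : False := by
  have haS : a ∈ S := hb.1
  have hbS : b ∈ S := hc.1
  have hcS : c ∈ S := hb.2.1
  have huS : u ∈ S := ha.1
  have hwS : w ∈ S := hu.1
  have hau : H.Adj a u := (ha.adj_iff huS).2 (Or.inl rfl)
  have hab : H.Adj a b := (ha.adj_iff hbS).2 (Or.inr rfl)
  have hcw : H.Adj c w := (hc.adj_iff hwS).2 (Or.inr rfl)
  have hbc : H.Adj b c := (hb.adj_iff hcS).2 (Or.inr rfl)
  have huw : H.Adj u w := (hu.adj_iff hwS).2 (Or.inl rfl)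
  have hac : a ≠ c := hb.2.2.1
  have hub : u ≠ b := ha.2.2.1
  have huc : c ≠ u := hw.2.2.1
  have hwa : w ≠ a := hu.2.2.1
  have hbw : b ≠ w := hc.2.2.1
  have hS : insert w {u, a, b, c} = S := by
    refine h.conn _ ?_ ⟨a, by simp⟩ ?_
    · simp [Finset.insert_subset_iff, *]
    · intro x hx y hy hxy
      simp only [Finset.mem_insert, Finset.mem_singleton] at hx ⊢
      rcases hx with rfl | rfl | rfl | rfl | rfl
      · rcases (hw.adj_iff hy).1 hxy with rfl | rfl <;> tauto
      · rcases (hu.adj_iff hy).1 hxy with rfl | rfl <;> tauto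
      · rcases (ha.adj_iff hy).1 hxy with rfl | rfl <;> tauto
      · rcases (hb.adj_iff hy).1 hxy with rfl | rfl <;> tauto
      · rcases (hc.adj_iff hy).1 hxy with rfl | rfl <;> tauto
  refine h.not_cheap ⟨{a, c}, by simp [Finset.insert_subset_iff, *], ?_, ?_⟩
  · intro v hv
    rw [← hS] at hv
    simp only [Finset.mem_insert, Finset.mem_singleton] at hv
    rcases hv with rfl | rfl | rfl | rfl | rfl
    · exact Or.inr ⟨c, by simp, hcw⟩
    · exact Or.inr ⟨a, by simp, hau⟩
    · exact Or.inl (by simp)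
    · exact Or.inr ⟨a, by simp, hab⟩
    · exact Or.inl (by simp)
  · have h4 : S.card = 5 := by
      rw [← hS, Finset.card_insert_of_notMem,
        card_quadruple hau.ne' hub huc.symm hab.ne hac hbc.ne]
      simp only [Finset.mem_insert, Finset.mem_singleton, not_or]
      exact ⟨huw.ne', hwa, hbw.symm, hcw.ne'⟩
    have := Finset.card_le_two (a := a) (b := c)
    omega

theorem MaxPaid.false_of_chain {H : SimpleGraph V} {S T : Finset V} {u a b c w : V}
    (hT : MaxPaid H S T) (h : MinCex H S) (haT : a ∉ T) (ha : HasNbrs H S a u b)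
    (hb : HasNbrs H S b a c) (hc : HasNbrs H S c b w) : False := by
  have haS : a ∈ S := hb.1
  have hbS : b ∈ S := hc.1
  have hcS : c ∈ S := hb.2.1
  have huS : u ∈ S := ha.1
  have hwS : w ∈ S := hc.2.1
  have hau : H.Adj a u := (ha.adj_iff huS).2 (Or.inl rfl)
  have hab : H.Adj a b := (ha.adj_iff hbS).2 (Or.inr rfl)
  have hbc : H.Adj b c := (hb.adj_iff hcS).2 (Or.inr rfl)
  have hcw : H.Adj c w := (hc.adj_iff hwS).2 (Or.inr rfl)
  have huT := hT.notMem_of_adj haS haT ha.card_eq_two hau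
  have hbT := hT.notMem_of_adj haS haT ha.card_eq_two hab
  have hcT := hT.notMem_of_adj hbS hbT hb.card_eq_two hbc
  have hwT := hT.notMem_of_adj hcS hcT hc.card_eq_two hcw
  by_cases huc : u = c
  · subst huc
    have hwa : w = a := by
      have := (hc.adj_iff haS).1 hau.symm
      have := hab.ne
      tauto
    subst hwa
    exact h.false_of_triangle ha hb hc
  by_cases huw : u = w
  · subst huw
    obtain ⟨x, hxS, -, hx3, hux, -⟩ := h.exists_large_of_square ha hb hc
    have hu3 := h.card_nbrs_of_square ha hb hc
    have huX : u ∈ S \ T := Finset.mem_sdiff.2 ⟨huS, huT⟩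
    have hxT : x ∉ T := by
      obtain ⟨⟨D, hD⟩, -⟩ := hT
      intro hxT
      exact (hD.large x hxT u huX hux.symm).2 ⟨a, b, c, ha, hb, hc⟩
    exact hT.not_adj_of_large h huX (Finset.mem_sdiff.2 ⟨hxS, hxT⟩) hu3.ge hx3 hux
  have huw' := h.adj_of_chain ha hb hc huw huc
  have hua2 : w ≠ a := by
    rintro rfl
    have := (ha.adj_iff hcS).1 hcw.symm
    have := hbc.ne'
    grind
  have hu2 := h.deg u huS
  have hw2 := h.deg w hwS
  by_cases hu3 : 3 ≤ (nbrs H S u).card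
  · by_cases hw3 : 3 ≤ (nbrs H S w).card
    · exact hT.not_adj_of_large h (Finset.mem_sdiff.2 ⟨huS, huT⟩) (Finset.mem_sdiff.2 ⟨hwS, hwT⟩)
        hu3 hw3 huw'
    · obtain ⟨y, hy⟩ := exists_hasNbrs (show (nbrs H S w).card = 2 by omega) huS huw'.symm
      obtain rfl : c = y := ((hy.adj_iff hcS).1 hcw.symm).resolve_left (Ne.symm huc)
      exact hT.false_of_loop h hcT hy hc.symm hb.symm ha.symm hu3
  · obtain ⟨y, hy⟩ := exists_hasNbrs (show (nbrs H S u).card = 2 by omega) hwS huw'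
    obtain rfl : a = y := ((hy.adj_iff haS).1 hau.symm).resolve_left (Ne.symm hua2)
    by_cases hw3 : 3 ≤ (nbrs H S w).card
    · exact hT.false_of_loop h haT hy ha hb hc hw3
    · obtain ⟨y', hy'⟩ := exists_hasNbrs (show (nbrs H S w).card = 2 by omega) huS huw'.symm
      obtain rfl : c = y' := ((hy'.adj_iff hcS).1 hcw.symm).resolve_left (Ne.symm huc)
      exact h.false_of_pentagon hy ha hb hc hy'.symm

theorem MaxPaid.large_of_notMem {H : SimpleGraph V} {S T : Finset V} {s : V}
    (hT : MaxPaid H S T) (h : MinCex H S) (hs : s ∈ S) (hsT : s ∉ T) :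
    3 ≤ (nbrs H S s).card := by
  by_contra hs3
  have hs2 : (nbrs H S s).card = 2 := by
    have := h.deg s hs
    omega
  have key : ∀ p q, HasNbrs H S s p q → 3 ≤ (nbrs H S p).card := by
    intro p q hn
    by_contra hp3
    have hp2 : (nbrs H S p).card = 2 := by
      have := h.deg p hn.1
      omega
    have hsp : H.Adj s p := (hn.adj_iff hn.1).2 (Or.inl rfl)
    have hpT := hT.notMem_of_adj hs hsT hs2 hsp
    obtain ⟨r, hr⟩ := exists_hasNbrs hp2 hs hsp.symm
    by_cases hq3 : 3 ≤ (nbrs H S q).card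
    · by_cases hr3 : 3 ≤ (nbrs H S r).card
      · exact hT.false_of_pair h hsT hn.symm hr hq3 hr3
      · have hpr : H.Adj p r := (hr.adj_iff hr.2.1).2 (Or.inr rfl)
        obtain ⟨t, ht⟩ := exists_hasNbrs (show (nbrs H S r).card = 2 by
          have := h.deg r hr.2.1
          omega) hn.1 hpr.symm
        exact hT.false_of_chain h hsT hn.symm hr ht
    · have hsq : H.Adj s q := (hn.adj_iff hn.2.1).2 (Or.inr rfl)
      obtain ⟨t, ht⟩ := exists_hasNbrs (show (nbrs H S q).card = 2 by
        have := h.deg q hn.2.1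
        omega) hs hsq.symm
      exact hT.false_of_chain h hpT hr.symm hn ht
  obtain ⟨p, hp⟩ : (nbrs H S s).Nonempty := Finset.card_pos.1 (by omega)
  rw [mem_nbrs] at hp
  obtain ⟨q, hn⟩ := exists_hasNbrs hs2 hp.1 hp.2
  exact hT.false_of_large_of_large h hs hsT hn (key _ _ hn) (key _ _ hn.symm)

theorem not_minCex (H : SimpleGraph V) (S : Finset V) : ¬ MinCex H S := by
  intro h
  obtain ⟨T, hT⟩ := exists_maxPaid H S
  obtain ⟨⟨D, hD⟩, -⟩ := id hT
  have hlarge : ∀ w ∈ S \ T, 3 ≤ (nbrs H S w).card := fun w hw =>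
    hT.large_of_notMem h (Finset.mem_sdiff.1 hw).1 (Finset.mem_sdiff.1 hw).2
  have hT3 : ∀ w ∈ S \ T, 3 ≤ (nbrs H T w).card := by
    intro w hw
    refine (hlarge w hw).trans (Finset.card_le_card fun x hx => ?_)
    rw [mem_nbrs] at hx ⊢
    refine ⟨by_contra fun hxT => ?_, hx.2⟩
    have hxX := Finset.mem_sdiff.2 ⟨hx.1, hxT⟩
    exact hT.not_adj_of_large h hw hxX (hlarge w hw) (hlarge x hxX) hx.2
  refine h.not_cheap ⟨D ∪ S \ T,
    Finset.union_subset (hD.subset_left.trans hD.subset) Finset.sdiff_subset, ?_, ?_⟩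
  · intro v hv
    by_cases hvT : v ∈ T
    · rcases hD.dom v hvT with h1 | ⟨d, hd, hdv⟩ | ⟨y, hy, hvy⟩
      · exact Or.inl (Finset.mem_union_left _ h1)
      · exact Or.inr ⟨d, Finset.mem_union_left _ hd, hdv⟩
      · exact Or.inr ⟨y, Finset.mem_union_right _ hy, hvy.symm⟩
    · exact Or.inl (Finset.mem_union_right _ (Finset.mem_sdiff.2 ⟨hv, hvT⟩))
  · have h1 := hD.card_le T subset_rfl fun _ _ _ hy _ => hy
    rw [Finset.inter_eq_left.2 hD.subset_left] at h1
    have h2 := Finset.card_nsmul_le_sum _ _ _ hT3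
    have h3 := Finset.card_sdiff_add_card_eq_card hD.subset
    have h4 := Finset.card_union_le D (S \ T)
    rw [smul_eq_mul] at h2
    omega

theorem Adm.cheap_or_critical [Finite V] {H : SimpleGraph V} {S : Finset V} (h : Adm H S) :
    Cheap H S ∨ Critical H S := by
  induction hn : S.card using Nat.strong_induction_on generalizing H S with
  | _ n ih =>
    subst hn
    induction H using WellFoundedLT.induction with
    | _ H ihH =>
      by_contra hcon
      rw [not_or] at hcon
      exact not_minCex H S
        { toAdm := h
          not_cheap := hcon.1
          not_critical := hcon.2
          of_card_lt := fun H' S' hlt h' => ih _ hlt h' rfl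
          of_lt := fun H' hlt h' => ihH H' hlt h' }

end TwoFifths

/-- Every connected simple graph with `n ≥ 8` vertices and minimum degree at least two has a
dominating set of size at most `2n/5`. -/
theorem exists_dominatingSet_card_le_two_fifths {V : Type*} [Fintype V] [DecidableEq V]
    (G : SimpleGraph V) [DecidableRel G.Adj] (hconn : G.Connected)
    (hn : 8 ≤ Fintype.card V) (hdeg : ∀ v : V, 2 ≤ G.degree v) :
    ∃ D : Finset V, IsDominatingSet G D ∧ 5 * D.card ≤ 2 * Fintype.card V := by
  have hadm : TwoFifths.Adm G Finset.univ := by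
    refine ⟨TwoFifths.conn_univ hconn, fun v _ => (hdeg v).trans_eq ?_⟩
    rw [← G.card_neighborFinset_eq_degree]
    congr 1
    ext x
    simp
  rcases hadm.cheap_or_critical with ⟨D, -, hD, hcard⟩ | hcrit
  · exact ⟨D, fun v => hD v (Finset.mem_univ v), hcard⟩
  · have := hcrit.1
    rw [Finset.card_univ] at this
    omega
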